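/- ℚ-desingularization of Schubert varieties: For every partition λ = (λ_1,…,λ_m) with n ≥ λ_1 ≥ ⋯ ≥ λ_m ≥ 0, the Schubert variety σ_λ ⊆ ℝ^{(m+n)²} admits a ℚ-desingularization: there exist p ∈ ℕ and a projectively ℚ-closed ℚ-nonsingular ℚ-algebraic set Z ⊆ ℝ^{(m+n)²} × ℝ^p of dimension mn − |λ| such that the projection π onto ℝ^{(m+n)²} maps Z onto σ_λ and, for every A in the Schubert open cell Ω_λ, the fiber π⁻¹(A) ∩ Z consists of exactly one point. -/

import Mathlib

open MvPolynomial

noncomputable section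

variable {ι κ : Type*} [Fintype ι] [DecidableEq ι] [Fintype κ]

/-- `V ⊆ ℝ^ι` is a `ℚ`-algebraic set: the common zero set of finitely many
polynomials with rational coefficients. -/
def IsQAlgebraicSet (V : Set (ι → ℝ)) : Prop :=
  ∃ S : Finset (MvPolynomial ι ℚ), V = {x : ι → ℝ | ∀ p ∈ S, aeval x p = 0}

/-- The gradient of a polynomial with rational coefficients at a real point. -/
def polyGradQ (p : MvPolynomial ι ℚ) (a : ι → ℝ) : ι → ℝ :=
  fun i => aeval a (pderiv i p)

/-- `V` is a `d`-dimensional `C^∞` submanifold of `ℝ^ι`: near each of its points it is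
the regular zero set of a `C^∞` submersion with values in `ℝ^(card ι - d)`. -/
def IsSmoothSubmanifold (d : ℕ) (V : Set (ι → ℝ)) : Prop :=
  ∀ a ∈ V, ∃ (U : Set (ι → ℝ)) (f : (ι → ℝ) → (Fin (Fintype.card ι - d) → ℝ)),
    IsOpen U ∧ a ∈ U ∧ ContDiffOn ℝ (⊤ : ℕ∞) f U ∧
    (∀ x ∈ U, Function.Surjective (fderiv ℝ f x)) ∧
    V ∩ U = {x ∈ U | f x = 0}

/-- `V` is a `ℚ`-nonsingular `ℚ`-algebraic set of dimension `d`. -/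
def IsQNonsingular (d : ℕ) (V : Set (ι → ℝ)) : Prop :=
  IsQAlgebraicSet V ∧ IsSmoothSubmanifold d V ∧
    ∀ a ∈ V, ∃ q : Fin (Fintype.card ι - d) → MvPolynomial ι ℚ,
      (∀ j, ∀ x ∈ V, aeval x (q j) = 0) ∧
      LinearIndependent ℝ (fun j => polyGradQ (q j) a) ∧
      ∃ U : Set (ι → ℝ), IsOpen U ∧ a ∈ U ∧
        V ∩ U = {x ∈ U | ∀ j, aeval x (q j) = 0}

/-- A real polynomial is overt if the zero set of its top-degree homogeneous
component is contained in `{0}`. -/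
def IsOvert (p : MvPolynomial ι ℝ) : Prop :=
  ∀ x : ι → ℝ, eval x (homogeneousComponent p.totalDegree p) = 0 → x = 0

/-- `V` is projectively `ℚ`-closed: the zero set of a single overt polynomial with
rational coefficients. -/
def IsProjQClosed (V : Set (ι → ℝ)) : Prop :=
  ∃ p : MvPolynomial ι ℚ, IsOvert (MvPolynomial.map (algebraMap ℚ ℝ) p) ∧
    V = {x : ι → ℝ | aeval x p = 0}

/-- `V ⊆ ℝ^ι` is a real algebraic set. -/
def IsRAlgebraicSet (V : Set (ι → ℝ)) : Prop :=
  ∃ S : Finset (MvPolynomial ι ℝ), V = {x : ι → ℝ | ∀ p ∈ S, eval x p = 0}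

/-- The gradient of a real polynomial at a point. -/
def polyGradR (p : MvPolynomial ι ℝ) (a : ι → ℝ) : ι → ℝ :=
  fun i => eval a (pderiv i p)

/-- `V` is a nonsingular real algebraic set of dimension `d`. -/
def IsNonsingularRAlgebraic (d : ℕ) (V : Set (ι → ℝ)) : Prop :=
  IsRAlgebraicSet V ∧ IsSmoothSubmanifold d V ∧
    ∀ a ∈ V, ∃ q : Fin (Fintype.card ι - d) → MvPolynomial ι ℝ,
      (∀ j, ∀ x ∈ V, eval x (q j) = 0) ∧
      LinearIndependent ℝ (fun j => polyGradR (q j) a) ∧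
      ∃ U : Set (ι → ℝ), IsOpen U ∧ a ∈ U ∧
        V ∩ U = {x ∈ U | ∀ j, eval x (q j) = 0}

/-- The tangent space of `M` at `a`, realized as the span of the tangent cone. -/
def tangentSpan (M : Set (ι → ℝ)) (a : ι → ℝ) : Submodule ℝ (ι → ℝ) :=
  Submodule.span ℝ (tangentConeAt ℝ M a)

/-- The submanifolds `Ms i` of `M`, of codimensions `c i`, are in general position. -/
def InGeneralPosition {ℓ : ℕ} (M : Set (ι → ℝ)) (Ms : Fin ℓ → Set (ι → ℝ))
    (c : Fin ℓ → ℕ) : Prop :=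
  ∀ α : Finset (Fin ℓ), α.Nonempty → ∀ a : ι → ℝ, (∀ i ∈ α, a ∈ Ms i) →
    Module.finrank ℝ ↥(⨅ i ∈ α, tangentSpan (Ms i) a) + ∑ i ∈ α, c i
      = Module.finrank ℝ ↥(tangentSpan M a)

/-- A `ℚ`-regular map on `S`: each component is a quotient of polynomials with
rational coefficients whose denominator does not vanish on `S`. -/
def IsQRegularMap (S : Set (ι → ℝ)) (g : (ι → ℝ) → κ → ℝ) : Prop :=
  ∀ j : κ, ∃ p q : MvPolynomial ι ℚ, (∀ x ∈ S, aeval x q ≠ 0) ∧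
    ∀ x ∈ S, g x j = aeval x p / aeval x q

/-- A map whose components are restrictions of polynomials with rational coefficients. -/
def IsQPolynomialMap {κ' : Type*} (S : Set (ι → ℝ)) (g : (ι → ℝ) → κ' → ℝ) : Prop :=
  ∀ j : κ', ∃ p : MvPolynomial ι ℚ, ∀ x ∈ S, g x j = aeval x p

/-- `f` restricts to a `C^∞` diffeomorphism from `A` onto `B`. -/
def IsSmoothDiffeoOn (f : (ι → ℝ) → κ → ℝ) (A : Set (ι → ℝ)) (B : Set (κ → ℝ)) : Prop :=
  Set.BijOn f A B ∧ ContDiffOn ℝ (⊤ : ℕ∞) f A ∧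
    ∃ g : (κ → ℝ) → ι → ℝ, ContDiffOn ℝ (⊤ : ℕ∞) g B ∧ Set.InvOn g f A B

/-- `L` is a `ℚ`-nice `ℚ`-algebraic set. -/
def IsQNice (L : Set (ι → ℝ)) : Prop :=
  ∀ a ∈ L, ∃ U : Set (ι → ℝ), IsOpen U ∧ a ∈ U ∧
    ∀ f : (ι → ℝ) → ℝ, ContDiff ℝ (⊤ : ℕ∞) f → (∀ x ∈ L, f x = 0) →
      ∃ (s : ℕ) (pp : Fin s → MvPolynomial ι ℚ) (u : Fin s → (ι → ℝ) → ℝ),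
        (∀ i, ∀ x ∈ L, aeval x (pp i) = 0) ∧
        (∀ i, ContDiffOn ℝ (⊤ : ℕ∞) (u i) U) ∧
        ∀ x ∈ U, f x = ∑ i, u i x * aeval x (pp i)

/-- Inclusion `ℝ^a ⊆ ℝ^b` via the first `a` coordinates. -/
def inclZero {a b : ℕ} (_ : a ≤ b) (x : Fin a → ℝ) : Fin b → ℝ :=
  fun j => if hj : (j : ℕ) < a then x ⟨j, hj⟩ else 0

/-- Reading a point of `ℝ^(k×k)` as a `k × k` matrix. -/
def matOf {k : ℕ} (x : Fin k × Fin k → ℝ) : Matrix (Fin k) (Fin k) ℝ :=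
  Matrix.of fun i j => x (i, j)

/-- The symmetric idempotent matrices of size `k` and trace `r`. -/
def GrassMatrix (k r : ℕ) : Set (Matrix (Fin k) (Fin k) ℝ) :=
  {X | X.transpose = X ∧ X * X = X ∧ X.trace = (r : ℝ)}

/-- The Grassmannian `G_{m,n}` embedded in `ℝ^{(m+n)²}`. -/
def Grass (m n : ℕ) : Set (Fin (m + n) × Fin (m + n) → ℝ) :=
  {x | matOf x ∈ GrassMatrix (m + n) m}

/-- The diagonal matrix `D_ℓ` with `1` in the first `ℓ` diagonal entries and `0` elsewhere. -/
def stdProj (k ℓ : ℕ) : Matrix (Fin k) (Fin k) ℝ :=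
  Matrix.diagonal fun i => if (i : ℕ) < ℓ then 1 else 0

/-- The coordinate subspace `ℝ^ℓ ⊆ ℝ^k` (first `ℓ` coordinates). -/
def coordSubspace (k ℓ : ℕ) : Submodule ℝ (Fin k → ℝ) :=
  ⨅ i ∈ {i : Fin k | ℓ ≤ (i : ℕ)},
    LinearMap.ker (LinearMap.proj (R := ℝ) (φ := fun _ : Fin k => ℝ) i)

/-- The column space of a square matrix. -/
def colSpace {k : ℕ} (X : Matrix (Fin k) (Fin k) ℝ) : Submodule ℝ (Fin k → ℝ) :=
  LinearMap.range X.mulVecLin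

/-- `lam` is a partition inside the `m × n` rectangle. -/
def IsPartitionIn (n : ℕ) {m : ℕ} (lam : Fin m → ℕ) : Prop :=
  (∀ k, lam k ≤ n) ∧ Antitone lam

/-- The Schubert variety `σ_λ ⊆ G_{m,n}` with respect to the canonical complete flag. -/
def SchubertVariety (m n : ℕ) (lam : Fin m → ℕ) :
    Set (Fin (m + n) × Fin (m + n) → ℝ) :=
  {x | x ∈ Grass m n ∧ ∀ k : Fin m,
    ((matOf x - 1) * stdProj (m + n) (n + ((k : ℕ) + 1) - lam k)).rank ≤ n - lam k}

/-- `λ_{k+1}`, with the convention `λ_{m+1} = 0`. -/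
def lamNext {m : ℕ} (lam : Fin m → ℕ) (k : Fin m) : ℕ :=
  if h : (k : ℕ) + 1 < m then lam ⟨(k : ℕ) + 1, h⟩ else 0

/-- The open Schubert cell `Ω_λ ⊆ G_{m,n}` with respect to the canonical complete flag. -/
def SchubertCell (m n : ℕ) (lam : Fin m → ℕ) :
    Set (Fin (m + n) × Fin (m + n) → ℝ) :=
  {x | x ∈ Grass m n ∧ ∀ k : Fin m, ∀ ℓ : ℕ,
    n + ((k : ℕ) + 1) - lam k ≤ ℓ → ℓ ≤ n + ((k : ℕ) + 1) - lamNext lam k →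
    Module.finrank ℝ ↥(colSpace (matOf x) ⊓ coordSubspace (m + n) ℓ) = (k : ℕ) + 1}

/-- `f 0 + ⋯ + f (t-1)` for `f : Fin c → ℕ`. -/
def partialSum {c : ℕ} (f : Fin c → ℕ) (t : ℕ) : ℕ :=
  ∑ i ∈ Finset.univ.filter (fun i : Fin c => (i : ℕ) < t), f i

/-- The `j`-th matrix slot of a point of `(ℝ^{k×k})^c`. -/
def matSlot {c k : ℕ} (z : Fin c × (Fin k × Fin k) → ℝ) (j : Fin c) :
    Matrix (Fin k) (Fin k) ℝ :=
  Matrix.of fun p q => z (j, (p, q))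

/-- The embedded Bott–Samelson set `Z_λ`, with slot `0` carrying `X` and slot `k`
(`1 ≤ k ≤ c-1`) carrying `Y_k`. -/
def BottSamelson (m n c : ℕ) (hc : 0 < c) (a b : Fin c → ℕ) :
    Set (Fin c × (Fin (m + n) × Fin (m + n)) → ℝ) :=
  {z | matSlot z ⟨0, hc⟩ ∈ GrassMatrix (m + n) m ∧
    (∀ j : Fin c, 0 < (j : ℕ) →
      matSlot z j ∈ GrassMatrix (m + n) (partialSum a (j : ℕ)) ∧
      matSlot z j * stdProj (m + n) (partialSum a (j : ℕ) + partialSum b (j : ℕ))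
        = matSlot z j) ∧
    (∀ (j : Fin c), 0 < (j : ℕ) → ∀ (h2 : (j : ℕ) + 1 < c),
      matSlot z ⟨(j : ℕ) + 1, h2⟩ * matSlot z j = matSlot z j) ∧
    (∀ j : Fin c, 0 < (j : ℕ) → (j : ℕ) = c - 1 →
      matSlot z ⟨0, hc⟩ * matSlot z j = matSlot z j)}

end

section QAlgebraic

variable {ι : Type*}

theorem isQAlgebraicSet_zeroLocus (p : MvPolynomial ι ℚ) :
    IsQAlgebraicSet {x : ι → ℝ | aeval x p = 0} :=
  ⟨{p}, by simp⟩

theorem IsQAlgebraicSet.iInter {τ : Type*} [Finite τ] {V : τ → Set (ι → ℝ)}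
    (hV : ∀ t, IsQAlgebraicSet (V t)) : IsQAlgebraicSet (⋂ t, V t) := by
  classical
  have := Fintype.ofFinite τ
  choose S hS using hV
  refine ⟨Finset.univ.biUnion S, ?_⟩
  ext x
  simp only [Set.mem_iInter, Set.mem_ofPred_eq, Finset.mem_biUnion, Finset.mem_univ, true_and]
  constructor
  · rintro h p ⟨t, ht⟩
    have := h t
    rw [hS t] at this
    exact this p ht
  · intro h t
    rw [hS t]
    exact fun p hp => h p ⟨t, hp⟩

theorem IsQAlgebraicSet.setOf_forall {τ : Type*} [Finite τ] {Q : τ → (ι → ℝ) → Prop}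
    (hQ : ∀ t, IsQAlgebraicSet {x | Q t x}) : IsQAlgebraicSet {x | ∀ t, Q t x} := by
  simpa [Set.ofPred_forall] using IsQAlgebraicSet.iInter hQ

theorem IsQAlgebraicSet.setOf_and {Q R : (ι → ℝ) → Prop}
    (hQ : IsQAlgebraicSet {x | Q x}) (hR : IsQAlgebraicSet {x | R x}) :
    IsQAlgebraicSet {x | Q x ∧ R x} := by
  have := IsQAlgebraicSet.setOf_forall (Q := fun b : Bool => cond b Q R)
    (by rintro (_ | _) <;> assumption)
  simpa [and_comm] using this

theorem IsQAlgebraicSet.setOf_imp {Q : (ι → ℝ) → Prop} {c : Prop}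
    (hQ : IsQAlgebraicSet {x | Q x}) : IsQAlgebraicSet {x | c → Q x} := by
  by_cases hc : c
  · simpa [hc] using hQ
  · exact ⟨∅, by simp [hc]⟩

variable [Fintype ι]

theorem exists_sub_C_pow_eq {σ R : Type*} [CommRing R] (S : MvPolynomial σ R)
    (hS : S.totalDegree ≤ 2) (c : R) (k : ℕ) :
    ∃ T : MvPolynomial σ R, (S - C c) ^ (k + 1) = S ^ (k + 1) + T ∧
      T.totalDegree < 2 * (k + 1) := by
  induction k with
  | zero => exact ⟨-C c, by ring, by simp⟩
  | succ k ih =>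
    obtain ⟨T, hT, hd⟩ := ih
    refine ⟨T * S - S ^ (k + 1) * C c - T * C c, by rw [pow_succ, hT]; ring, ?_⟩
    have hTS : (T * S).totalDegree ≤ T.totalDegree + 2 :=
      (totalDegree_mul _ _).trans (by gcongr)
    have hSc : (S ^ (k + 1) * C c).totalDegree ≤ (k + 1) * 2 := by
      refine (totalDegree_mul _ _).trans ?_
      rw [totalDegree_C, add_zero]
      exact (totalDegree_pow _ _).trans (by gcongr)
    have hTc : (T * C c).totalDegree ≤ T.totalDegree := by
      simpa using totalDegree_mul T (C c)
    have h₁ := totalDegree_sub (T * S - S ^ (k + 1) * C c) (T * C c)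
    have h₂ := totalDegree_sub (T * S) (S ^ (k + 1) * C c)
    omega

/-- A polynomial whose leading form is a power of the sum of the squared coordinates is overt. -/
theorem isOvert_of_eq_sum_sq_pow_add {P T : MvPolynomial ι ℝ} {k : ℕ}
    (hP : P = (∑ i, X i ^ 2) ^ k + T) (hT : T.totalDegree < 2 * k) : IsOvert P := by
  intro x hx
  have hhom : ((∑ i, X i ^ 2 : MvPolynomial ι ℝ) ^ k).IsHomogeneous (2 * k) :=
    (IsHomogeneous.sum _ _ _ fun i _ => isHomogeneous_X_pow i 2).pow k
  have hcomp : homogeneousComponent (2 * k) P = (∑ i, X i ^ 2) ^ k := by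
    rw [hP, map_add, homogeneousComponent_eq_self hhom, homogeneousComponent_eq_zero _ _ hT,
      add_zero]
  have hsum : ∀ y : ι → ℝ, eval y ((∑ i, X i ^ 2 : MvPolynomial ι ℝ) ^ k) = 0 → y = 0 := by
    intro y hy
    have h0 : ∑ i, y i ^ 2 = 0 := by
      have hk : k ≠ 0 := by omega
      simpa [hk] using hy
    funext i
    simpa using (Finset.sum_eq_zero_iff_of_nonneg fun i _ => sq_nonneg (y i)).1 h0 i
      (Finset.mem_univ i)
  by_contra hne
  have hdeg : P.totalDegree = 2 * k := by
    apply le_antisymm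
    · rw [hP]
      exact (totalDegree_add _ _).trans (max_le hhom.totalDegree_le hT.le)
    · by_contra hlt
      rw [homogeneousComponent_eq_zero _ _ (not_le.1 hlt)] at hcomp
      exact hne (hsum x (by rw [← hcomp, map_zero]))
  rw [hdeg, hcomp] at hx
  exact hne (hsum x hx)

/-- A `ℚ`-algebraic set contained in a sphere around the origin whose squared radius is rational
is projectively `ℚ`-closed. -/
theorem IsQAlgebraicSet.isProjQClosed {V : Set (ι → ℝ)} (hV : IsQAlgebraicSet V) (c : ℚ)
    (hc : ∀ x ∈ V, ∑ i, x i ^ 2 = (c : ℝ)) : IsProjQClosed V := by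
  obtain ⟨S, hS⟩ := hV
  set Q : MvPolynomial ι ℚ := ∑ p ∈ S, p ^ 2 with hQ
  set k := 2 * (MvPolynomial.map (algebraMap ℚ ℝ) Q).totalDegree + 1 with hk
  refine ⟨(∑ i, X i ^ 2 - C c) ^ (k + 1) + Q, ?_, ?_⟩
  · obtain ⟨T, hT, hd⟩ := exists_sub_C_pow_eq (∑ i, X i ^ 2 : MvPolynomial ι ℝ)
      (IsHomogeneous.sum _ _ _ fun i _ => isHomogeneous_X_pow i 2).totalDegree_le (c : ℝ) k
    refine isOvert_of_eq_sum_sq_pow_add (k := k + 1)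
      (T := T + MvPolynomial.map (algebraMap ℚ ℝ) Q) ?_ ?_
    · simp only [map_add, map_pow, map_sub, map_sum, map_X, map_C, eq_ratCast, hT]
      ring
    · have h₁ := totalDegree_add T (MvPolynomial.map (algebraMap ℚ ℝ) Q)
      omega
  · have hev : ∀ x : ι → ℝ, aeval x ((∑ i, X i ^ 2 - C c) ^ (k + 1) + Q)
        = (∑ i, x i ^ 2 - (c : ℝ)) ^ (k + 1) + ∑ p ∈ S, aeval x p ^ 2 := by
      intro x
      simp [hQ]
    have heven : Even (k + 1) := ⟨(MvPolynomial.map (algebraMap ℚ ℝ) Q).totalDegree + 1, by omega⟩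
    ext x
    rw [Set.mem_ofPred_eq, hev]
    constructor
    · intro hx
      rw [hc x hx, sub_self, zero_pow (by omega), zero_add]
      rw [hS] at hx
      exact Finset.sum_eq_zero fun p hp => by rw [hx p hp]; norm_num
    · intro hx
      have h₁ := heven.pow_nonneg (∑ i, x i ^ 2 - (c : ℝ))
      have h₂ : 0 ≤ ∑ p ∈ S, aeval x p ^ 2 := Finset.sum_nonneg fun p _ => sq_nonneg _
      have h₃ : ∑ p ∈ S, aeval x p ^ 2 = 0 := by linarith
      rw [hS]
      intro p hp
      simpa using (Finset.sum_eq_zero_iff_of_nonneg fun p _ => sq_nonneg (aeval x p)).1 h₃ p hp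

theorem hasFDerivAt_aeval (p : MvPolynomial ι ℚ) (x : ι → ℝ) :
    HasFDerivAt (fun y : ι → ℝ => aeval y p)
      (∑ i, polyGradQ p x i • ContinuousLinearMap.proj (R := ℝ) (φ := fun _ : ι => ℝ) i) x := by
  classical
  induction p using MvPolynomial.induction_on with
  | C r =>
    simp only [aeval_C]
    exact (hasFDerivAt_const (𝕜 := ℝ) (algebraMap ℚ ℝ r) x).congr_fderiv (by simp [polyGradQ])
  | add p q hp hq =>
    simp only [map_add]
    exact (hp.fun_add hq).congr_fderiv (by simp [polyGradQ, add_smul, Finset.sum_add_distrib])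
  | mul_X p i hp =>
    simp only [map_mul, aeval_X]
    refine (hp.fun_mul (hasFDerivAt_apply i x)).congr_fderiv ?_
    ext v
    simp [polyGradQ, pderiv_X, Pi.single_apply, add_mul, Finset.sum_add_distrib,
      Finset.mul_sum, mul_assoc, apply_ite]

theorem contDiff_aeval (p : MvPolynomial ι ℚ) :
    ContDiff ℝ (⊤ : ℕ∞) (fun y : ι → ℝ => aeval y p) := by
  induction p using MvPolynomial.induction_on with
  | C r => simpa using contDiff_const
  | add p q hp hq => simpa using hp.add hq
  | mul_X p i hp => simpa using hp.mul (contDiff_apply ℝ ℝ i)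

theorem surjective_dotProduct_of_linearIndependent {κ : Type*} [Fintype κ] {w : κ → ι → ℝ}
    (hw : LinearIndependent ℝ w) :
    Function.Surjective fun (v : ι → ℝ) (j : κ) => ∑ i, w j i * v i := by
  have hrank := hw.rank_matrix (M := Matrix.of w)
  have htop : LinearMap.range (Matrix.of w).mulVecLin = ⊤ := by
    apply Submodule.eq_top_of_finrank_eq
    rw [Module.finrank_fintype_fun_eq_card]
    exact hrank
  exact LinearMap.range_eq_top.1 htop

/-- A `ℚ`-algebraic set which near each point is cut out by the right number of polynomials with
independent gradients is `ℚ`-nonsingular. -/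
theorem IsQAlgebraicSet.isQNonsingular {d : ℕ} {V : Set (ι → ℝ)} (hV : IsQAlgebraicSet V)
    (h : ∀ a ∈ V, ∃ (E : Type) (_ : Fintype E) (q : E → MvPolynomial ι ℚ),
      Fintype.card E = Fintype.card ι - d ∧ (∀ e, ∀ x ∈ V, aeval x (q e) = 0) ∧
      LinearIndependent ℝ (fun e => polyGradQ (q e) a) ∧
      ∃ U : Set (ι → ℝ), IsOpen U ∧ a ∈ U ∧ ∀ x ∈ U, (∀ e, aeval x (q e) = 0) → x ∈ V) :
    IsQNonsingular d V := by
  have key : ∀ a ∈ V, ∃ q : Fin (Fintype.card ι - d) → MvPolynomial ι ℚ,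
      (∀ j, ∀ x ∈ V, aeval x (q j) = 0) ∧
      LinearIndependent ℝ (fun j => polyGradQ (q j) a) ∧
      ∃ U : Set (ι → ℝ), IsOpen U ∧ a ∈ U ∧
        V ∩ U = {x ∈ U | ∀ j, aeval x (q j) = 0} := by
    intro a ha
    obtain ⟨E, _, q, hcard, hq, hli, U, hU, haU, hUV⟩ := h a ha
    let e : Fin (Fintype.card ι - d) ≃ E := (Fintype.equivFinOfCardEq hcard).symm
    refine ⟨fun j => q (e j), fun j => hq (e j), hli.comp e e.injective, U, hU, haU, ?_⟩
    ext x
    constructor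
    · rintro ⟨hxV, hxU⟩
      exact ⟨hxU, fun j => hq _ x hxV⟩
    · rintro ⟨hxU, hx⟩
      exact ⟨hUV x hxU fun t => by simpa using hx (e.symm t), hxU⟩
  refine ⟨hV, fun a ha => ?_, key⟩
  obtain ⟨q, hq, hli, U, hU, haU, hUV⟩ := key a ha
  have hcont : Continuous fun (x : ι → ℝ) j => polyGradQ (q j) x :=
    continuous_pi fun j => continuous_pi fun i => (contDiff_aeval _).continuous
  refine ⟨U ∩ {x | LinearIndependent ℝ fun j => polyGradQ (q j) x}, fun x j => aeval x (q j),
    hU.inter (isOpen_setOfPred_linearIndependent.preimage hcont), ⟨haU, hli⟩,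
    (contDiff_pi.2 fun j => contDiff_aeval _).contDiffOn, ?_, ?_⟩
  · rintro x ⟨-, hx⟩
    have hder := hasFDerivAt_pi.2 fun j => hasFDerivAt_aeval (q j) x
    rw [hder.fderiv]
    convert surjective_dotProduct_of_linearIndependent hx using 1
    ext v j
    simp
  · ext x
    have := Set.ext_iff.1 hUV x
    simp only [Set.mem_inter_iff, Set.mem_ofPred_eq, funext_iff, Pi.zero_apply] at this ⊢
    tauto

end QAlgebraic

section ProjectionMatrices

variable {N : ℕ}

theorem rank_eq_trace_of_mul_self {X : Matrix (Fin N) (Fin N) ℝ} (hX : X * X = X) :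
    (X.rank : ℝ) = X.trace := by
  have hid : IsIdempotentElem (Matrix.toLin' X) := by
    rw [IsIdempotentElem, Module.End.mul_eq_comp, ← Matrix.toLin'_mul, hX]
  have h := ((LinearMap.isProj_range_iff_isIdempotentElem _).2 hid).trace
  rw [Matrix.trace_toLin'_eq] at h
  exact h.symm

theorem sum_sq_eq_trace {X : Matrix (Fin N) (Fin N) ℝ} (hs : X.transpose = X)
    (hX : X * X = X) : ∑ r, ∑ c, X r c ^ 2 = X.trace := by
  have h : ∑ r, ∑ c, X r c ^ 2 = (X * X.transpose).trace := by
    simp only [Matrix.trace, Matrix.diag_apply, Matrix.mul_apply, Matrix.transpose_apply, sq]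
  rw [h, hs, hX]

theorem eq_zero_of_trace_eq_zero {X : Matrix (Fin N) (Fin N) ℝ} (hs : X.transpose = X)
    (hX : X * X = X) (ht : X.trace = 0) : X = 0 := by
  rw [← Matrix.trace_conjTranspose_mul_self_eq_zero_iff]
  simpa [Matrix.conjTranspose_eq_transpose_of_trivial, hs, hX] using ht

theorem mem_colSpace_iff {X : Matrix (Fin N) (Fin N) ℝ} (hX : X * X = X) {x : Fin N → ℝ} :
    x ∈ colSpace X ↔ X.mulVec x = x := by
  constructor
  · rintro ⟨y, rfl⟩
    simp [hX]
  · intro h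
    exact ⟨x, h⟩

theorem mem_coordSubspace_iff {ℓ : ℕ} {x : Fin N → ℝ} :
    x ∈ coordSubspace N ℓ ↔ ∀ i : Fin N, ℓ ≤ (i : ℕ) → x i = 0 := by
  simp [coordSubspace]

theorem colSpace_stdProj (ℓ : ℕ) : colSpace (stdProj N ℓ) = coordSubspace N ℓ := by
  ext x
  rw [mem_colSpace_iff, mem_coordSubspace_iff]
  · simp only [stdProj, funext_iff, Matrix.mulVec_diagonal]
    refine forall_congr' fun i => ?_
    by_cases h : (i : ℕ) < ℓ
    · simp [h]
    · simp [h, not_lt.1 h, eq_comm]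
  · simp [stdProj, Matrix.diagonal_mul_diagonal]

theorem finrank_coordSubspace {ℓ : ℕ} (hℓ : ℓ ≤ N) :
    Module.finrank ℝ (coordSubspace N ℓ) = ℓ := by
  have h := rank_eq_trace_of_mul_self (X := stdProj N ℓ)
    (by simp [stdProj, Matrix.diagonal_mul_diagonal])
  rw [← colSpace_stdProj]
  change (Module.finrank ℝ (colSpace (stdProj N ℓ)) : ℝ) = _ at h
  have ht : (stdProj N ℓ).trace = ℓ := by
    simp only [stdProj, Matrix.trace_diagonal, Finset.sum_boole]
    rw [Fin.card_filter_val_lt]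
    simp [hℓ]
  exact_mod_cast h.trans ht

theorem rank_sub_one_mul_stdProj {X : Matrix (Fin N) (Fin N) ℝ} (hX : X * X = X) {ℓ : ℕ}
    (hℓ : ℓ ≤ N) :
    ((X - 1) * stdProj N ℓ).rank + Module.finrank ℝ ↥(colSpace X ⊓ coordSubspace N ℓ) = ℓ := by
  have h := ((X - 1).mulVecLin.domRestrict (coordSubspace N ℓ)).finrank_range_add_finrank_ker
  rw [finrank_coordSubspace hℓ, LinearMap.range_domRestrict, LinearMap.ker_domRestrict] at h
  have hker : LinearMap.ker (X - 1).mulVecLin = colSpace X := by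
    ext x
    simp [mem_colSpace_iff hX, sub_eq_zero]
  have hrange : LinearMap.range ((X - 1) * stdProj N ℓ).mulVecLin
      = (coordSubspace N ℓ).map (X - 1).mulVecLin := by
    rw [Matrix.mulVecLin_mul, LinearMap.range_comp, ← colSpace_stdProj, colSpace]
  rw [hker, ← Submodule.finrank_map_subtype_eq, Submodule.map_comap_subtype, inf_comm] at h
  rw [Matrix.rank, hrange]
  exact h

theorem mul_eq_of_colSpace_le {A B : Matrix (Fin N) (Fin N) ℝ} (hA : A * A = A)
    (h : colSpace B ≤ colSpace A) : A * B = B := by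
  apply Matrix.toLin'.injective
  refine LinearMap.ext fun x => ?_
  have hx : B.mulVec x ∈ colSpace A := h ⟨x, rfl⟩
  rw [mem_colSpace_iff hA, Matrix.mulVec_mulVec] at hx
  exact hx

theorem eq_of_colSpace_eq {X Y : Matrix (Fin N) (Fin N) ℝ} (hXs : X.transpose = X)
    (hX : X * X = X) (hYs : Y.transpose = Y) (hY : Y * Y = Y) (h : colSpace X = colSpace Y) :
    X = Y := by
  have h₁ := congrArg Matrix.transpose (mul_eq_of_colSpace_le hY h.le)
  rw [Matrix.transpose_mul, hXs, hYs] at h₁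
  exact h₁.symm.trans (mul_eq_of_colSpace_le hX h.ge)

end ProjectionMatrices

/-- The matrices `P k` are pairwise orthogonal orthogonal projections onto lines, the line of `P k`
being contained in the span of the first `ℓ k` basis vectors. -/
structure IsLineFrame {m N : ℕ} (ℓ : Fin m → ℕ) (P : Fin m → Matrix (Fin N) (Fin N) ℝ) :
    Prop where
  symm : ∀ k r c, P k r c = P k c r
  minor : ∀ k r c s t, P k r c * P k s t = P k r t * P k s c
  trace : ∀ k, ∑ r, P k r r = 1
  support : ∀ k (r c : Fin N), ℓ k ≤ (r : ℕ) → P k r c = 0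
  ortho : ∀ j k, j ≠ k → ∀ r c, ∑ s, P j r s * P k s c = 0

namespace IsLineFrame

variable {m N : ℕ} {ℓ : Fin m → ℕ} {P P' : Fin m → Matrix (Fin N) (Fin N) ℝ}

theorem transpose_eq (hP : IsLineFrame ℓ P) (k : Fin m) : (P k).transpose = P k := by
  ext r c
  exact hP.symm k c r

theorem mul_self (hP : IsLineFrame ℓ P) (k : Fin m) : P k * P k = P k := by
  ext r c
  calc ∑ s, P k r s * P k s c = ∑ s, P k r c * P k s s :=
        Finset.sum_congr rfl fun s _ => hP.minor k r s s c
    _ = P k r c := by rw [← Finset.mul_sum, hP.trace, mul_one]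

theorem mul_eq_ite (hP : IsLineFrame ℓ P) (j k : Fin m) :
    P j * P k = if j = k then P j else 0 := by
  split_ifs with h
  · rw [← h, hP.mul_self]
  · ext r c
    exact hP.ortho j k h r c

theorem sum_sq (hP : IsLineFrame ℓ P) (k : Fin m) : ∑ r, ∑ c, P k r c ^ 2 = 1 := by
  rw [sum_sq_eq_trace (hP.transpose_eq k) (hP.mul_self k)]
  exact hP.trace k

theorem transpose_sum (hP : IsLineFrame ℓ P) (s : Finset (Fin m)) :
    (∑ k ∈ s, P k).transpose = ∑ k ∈ s, P k := by
  rw [Matrix.transpose_sum]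
  exact Finset.sum_congr rfl fun k _ => hP.transpose_eq k

theorem sum_mul_sum (hP : IsLineFrame ℓ P) {s t : Finset (Fin m)} (hst : s ⊆ t) :
    (∑ k ∈ t, P k) * ∑ k ∈ s, P k = ∑ k ∈ s, P k := by
  rw [Finset.mul_sum]
  refine Finset.sum_congr rfl fun k hk => ?_
  simp only [Finset.sum_mul, hP.mul_eq_ite, Finset.sum_ite_eq', if_pos (hst hk)]

theorem trace_sum (hP : IsLineFrame ℓ P) (s : Finset (Fin m)) :
    (∑ k ∈ s, P k).trace = s.card := by
  rw [Matrix.trace_sum]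
  simp [Matrix.trace, hP.trace]

theorem finrank_colSpace_sum (hP : IsLineFrame ℓ P) (s : Finset (Fin m)) :
    Module.finrank ℝ (colSpace (∑ k ∈ s, P k)) = s.card := by
  have h := rank_eq_trace_of_mul_self (hP.sum_mul_sum (subset_refl s))
  rw [hP.trace_sum] at h
  exact_mod_cast h

theorem colSpace_sum_le (hP : IsLineFrame ℓ P) (hℓ : Monotone ℓ) (k : Fin m) :
    colSpace (∑ j ∈ Finset.Iic k, P j) ≤ colSpace (∑ j, P j) ⊓ coordSubspace N (ℓ k) := by
  rintro _ ⟨x, rfl⟩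
  refine ⟨?_, mem_coordSubspace_iff.2 fun i hi => ?_⟩
  · refine ⟨(∑ j ∈ Finset.Iic k, P j).mulVec x, ?_⟩
    simp only [Matrix.mulVecLin_apply, Matrix.mulVec_mulVec]
    rw [hP.sum_mul_sum (Finset.subset_univ _)]
  · simp only [Matrix.mulVecLin_apply, Matrix.mulVec, dotProduct, Matrix.sum_apply]
    refine Finset.sum_eq_zero fun c _ => ?_
    rw [Finset.sum_eq_zero, zero_mul]
    exact fun j hj => hP.support j i c ((hℓ (Finset.mem_Iic.1 hj)).trans hi)

theorem le_finrank (hP : IsLineFrame ℓ P) (hℓ : Monotone ℓ) (k : Fin m) :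
    (k : ℕ) + 1 ≤ Module.finrank ℝ ↥(colSpace (∑ j, P j) ⊓ coordSubspace N (ℓ k)) := by
  have h := Submodule.finrank_mono (hP.colSpace_sum_le hℓ k)
  rwa [hP.finrank_colSpace_sum, Fin.card_Iic] at h

/-- A frame is determined by its sum when the intersections with the coordinate flag have the
minimal dimensions. -/
theorem eq_of_sum_eq (hP : IsLineFrame ℓ P) (hP' : IsLineFrame ℓ P') (hℓ : Monotone ℓ)
    (hsum : ∑ j, P j = ∑ j, P' j)
    (hdim : ∀ k : Fin m,
      Module.finrank ℝ ↥(colSpace (∑ j, P j) ⊓ coordSubspace N (ℓ k)) = (k : ℕ) + 1) :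
    P = P' := by
  have hcol : ∀ {Q : Fin m → Matrix (Fin N) (Fin N) ℝ}, IsLineFrame ℓ Q →
      ∑ j, P j = ∑ j, Q j → ∀ k, colSpace (∑ j ∈ Finset.Iic k, Q j)
        = colSpace (∑ j, P j) ⊓ coordSubspace N (ℓ k) := by
    intro Q hQ hPQ k
    apply Submodule.eq_of_le_of_finrank_eq
    · rw [hPQ]
      exact hQ.colSpace_sum_le hℓ k
    · rw [hdim, hQ.finrank_colSpace_sum, Fin.card_Iic]
  have hpart : ∀ k, ∑ j ∈ Finset.Iic k, P j = ∑ j ∈ Finset.Iic k, P' j := fun k =>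
    eq_of_colSpace_eq (hP.transpose_sum _) (hP.sum_mul_sum subset_rfl) (hP'.transpose_sum _)
      (hP'.sum_mul_sum subset_rfl) ((hcol hP rfl k).trans (hcol hP' hsum k).symm)
  funext k
  induction k using WellFoundedLT.induction with
  | _ k ih =>
    have h := hpart k
    rw [← Finset.Iio_insert, Finset.sum_insert (by simp), Finset.sum_insert (by simp),
      Finset.sum_congr rfl fun j hj => ih j (Finset.mem_Iio.1 hj)] at h
    exact add_right_cancel h

end IsLineFrame

theorem exists_unit_orthogonal {N K : ℕ} (W : Submodule ℝ (Fin N → ℝ))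
    (hW : K < Module.finrank ℝ W) (v : ℕ → Fin N → ℝ) :
    ∃ x ∈ W, x ⬝ᵥ x = 1 ∧ ∀ j < K, v j ⬝ᵥ x = 0 := by
  let f : W →ₗ[ℝ] (Fin K → ℝ) :=
    (Matrix.of fun (j : Fin K) => v j).mulVecLin.domRestrict W
  have hf : LinearMap.ker f ≠ ⊥ := f.ker_ne_bot_of_finrank_lt (by simpa using hW)
  obtain ⟨⟨y, hyW⟩, hy, hy0⟩ := (Submodule.ne_bot_iff _).1 hf
  have hy0 : y ≠ 0 := fun h => hy0 (Subtype.ext h)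
  have horth : ∀ j < K, v j ⬝ᵥ y = 0 := fun j hj => congrFun (LinearMap.mem_ker.1 hy) ⟨j, hj⟩
  have hpos : 0 < y ⬝ᵥ y :=
    lt_of_le_of_ne (Finset.sum_nonneg fun i _ => mul_self_nonneg (y i))
      fun h => hy0 (dotProduct_self_eq_zero.1 h.symm)
  refine ⟨(√(y ⬝ᵥ y))⁻¹ • y, W.smul_mem _ hyW, ?_, fun j hj => by simp [horth j hj]⟩
  rw [smul_dotProduct, dotProduct_smul, smul_eq_mul, smul_eq_mul, ← mul_assoc, ← mul_inv,
    Real.mul_self_sqrt hpos.le, inv_mul_cancel₀ hpos.ne']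

theorem exists_orthonormal_of_lt_finrank {N m : ℕ} (W : Fin m → Submodule ℝ (Fin N → ℝ))
    (hW : ∀ k : Fin m, (k : ℕ) < Module.finrank ℝ (W k)) :
    ∃ v : Fin m → Fin N → ℝ, (∀ k, v k ∈ W k) ∧
      ∀ j k, v j ⬝ᵥ v k = if j = k then 1 else 0 := by
  have key : ∀ K ≤ m, ∃ v : ℕ → Fin N → ℝ,
      (∀ k : Fin m, (k : ℕ) < K → v k ∈ W k ∧ v k ⬝ᵥ v k = 1) ∧
      ∀ j k, j < k → k < K → v j ⬝ᵥ v k = 0 := by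
    intro K
    induction K with
    | zero => exact fun _ => ⟨0, by simp, by simp⟩
    | succ K ih =>
      intro hK
      obtain ⟨v, hv, hvo⟩ := ih (by omega)
      obtain ⟨x, hxW, hx, hxo⟩ := exists_unit_orthogonal (W ⟨K, hK⟩) (hW ⟨K, hK⟩) v
      refine ⟨Function.update v K x, fun k hk => ?_, fun j k hjk hk => ?_⟩
      · rcases Nat.lt_succ_iff_lt_or_eq.1 hk with h | h
        · rw [Function.update_of_ne h.ne]
          exact hv k h
        · obtain rfl : k = ⟨K, hK⟩ := Fin.ext h
          simpa using ⟨hxW, hx⟩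
      · rw [Function.update_of_ne (by omega : j ≠ K)]
        rcases Nat.lt_succ_iff_lt_or_eq.1 hk with h | rfl
        · rw [Function.update_of_ne h.ne]
          exact hvo j k hjk h
        · rw [Function.update_self]
          exact hxo j hjk
  obtain ⟨v, hv, hvo⟩ := key m le_rfl
  refine ⟨fun k => v k, fun k => (hv k k.2).1, fun j k => ?_⟩
  rcases lt_trichotomy j k with h | rfl | h
  · rw [if_neg h.ne, hvo j k h k.2]
  · rw [if_pos rfl, (hv j j.2).2]
  · rw [if_neg h.ne', dotProduct_comm, hvo k j h j.2]

theorem exists_isLineFrame {m N : ℕ} {ℓ : Fin m → ℕ} {X : Matrix (Fin N) (Fin N) ℝ}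
    (hX : X ∈ GrassMatrix N m)
    (hdim : ∀ k : Fin m,
      (k : ℕ) < Module.finrank ℝ ↥(colSpace X ⊓ coordSubspace N (ℓ k))) :
    ∃ P, IsLineFrame ℓ P ∧ ∑ k, P k = X := by
  obtain ⟨hXs, hXX, hXt⟩ := hX
  obtain ⟨v, hvW, hvo⟩ := exists_orthonormal_of_lt_finrank _ hdim
  have hP : IsLineFrame ℓ fun k => Matrix.vecMulVec (v k) (v k) := by
    refine ⟨fun k r c => ?_, fun k r c s t => ?_, fun k => ?_, fun k r c h => ?_,
      fun j k h r c => ?_⟩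
    · simp [Matrix.vecMulVec_apply, mul_comm]
    · simp only [Matrix.vecMulVec_apply]
      ring
    · simpa [Matrix.vecMulVec_apply, dotProduct] using hvo k k
    · simp [Matrix.vecMulVec_apply, mem_coordSubspace_iff.1 (hvW k).2 r h]
    · have : (Matrix.vecMulVec (v j) (v j) * Matrix.vecMulVec (v k) (v k)) r c = 0 := by
        simp [Matrix.vecMulVec_mul_vecMulVec, hvo, h]
      exact this
  refine ⟨_, hP, ?_⟩
  set Y := ∑ k, Matrix.vecMulVec (v k) (v k) with hY
  have hYs : Y.transpose = Y := hP.transpose_sum _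
  have hYY : Y * Y = Y := hP.sum_mul_sum subset_rfl
  have hYt : Y.trace = m := by rw [hP.trace_sum, Finset.card_univ, Fintype.card_fin]
  have hXY : X * Y = Y := by
    rw [hY, Finset.mul_sum]
    refine Finset.sum_congr rfl fun k _ => ?_
    rw [Matrix.mul_vecMulVec, (mem_colSpace_iff hXX).1 (hvW k).1]
  have hYX : Y * X = Y := by
    have := congrArg Matrix.transpose hXY
    rwa [Matrix.transpose_mul, hXs, hYs] at this
  refine (sub_eq_zero.1 (eq_zero_of_trace_eq_zero ?_ ?_ ?_)).symm
  · rw [Matrix.transpose_sub, hXs, hYs]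
  · rw [sub_mul, mul_sub, mul_sub, hXX, hXY, hYX, hYY]
    abel
  · rw [Matrix.trace_sub, hXt, hYt, sub_self]

section DirectionalDerivative

variable {ι : Type*} [Fintype ι]

/-- The derivative of a polynomial with rational coefficients at `a` in the direction `v`. -/
noncomputable def polyDirDeriv (a v : ι → ℝ) (p : MvPolynomial ι ℚ) : ℝ :=
  ∑ i, polyGradQ p a i * v i

variable (a v : ι → ℝ)

theorem polyDirDeriv_X (i : ι) : polyDirDeriv a v (X i) = v i := by
  classical
  simp [polyDirDeriv, polyGradQ, pderiv_X, Pi.single_apply, apply_ite]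

theorem polyDirDeriv_sub (p q : MvPolynomial ι ℚ) :
    polyDirDeriv a v (p - q) = polyDirDeriv a v p - polyDirDeriv a v q := by
  simp [polyDirDeriv, polyGradQ, sub_mul]

theorem polyDirDeriv_zero : polyDirDeriv a v 0 = 0 := by
  simp [polyDirDeriv, polyGradQ]

theorem polyDirDeriv_sum {τ : Type*} (s : Finset τ) (f : τ → MvPolynomial ι ℚ) :
    polyDirDeriv a v (∑ t ∈ s, f t) = ∑ t ∈ s, polyDirDeriv a v (f t) := by
  simp only [polyDirDeriv, polyGradQ, map_sum, Finset.sum_mul]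
  exact Finset.sum_comm

theorem polyDirDeriv_mul (p q : MvPolynomial ι ℚ) :
    polyDirDeriv a v (p * q) = aeval a p * polyDirDeriv a v q + aeval a q * polyDirDeriv a v p := by
  simp [polyDirDeriv, polyGradQ, add_mul, Finset.sum_add_distrib, Finset.mul_sum, mul_assoc]

theorem linearIndependent_polyGradQ {E : Type*} [Fintype E] {q : E → MvPolynomial ι ℚ}
    (h : ∀ g : E → ℝ, (∀ v, ∑ e, g e * polyDirDeriv a v (q e) = 0) → ∀ e, g e = 0) :
    LinearIndependent ℝ fun e => polyGradQ (q e) a := by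
  rw [Fintype.linearIndependent_iff]
  refine fun g hg => h g fun v => ?_
  simp only [polyDirDeriv, Finset.mul_sum]
  rw [Finset.sum_comm]
  refine Finset.sum_eq_zero fun i _ => ?_
  have := congrFun hg i
  simp only [Finset.sum_apply, Pi.smul_apply, smul_eq_mul, Pi.zero_apply] at this
  simp only [← mul_assoc, ← Finset.sum_mul, this, zero_mul]

end DirectionalDerivative

section FrameVariety

variable {m N p : ℕ}

/-- The index of the `(r, c)` entry of the `k`-th matrix. -/
def frameIdx (e : Fin p ≃ Fin m × Fin N × Fin N) (k : Fin m) (r c : Fin N) :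
    (Fin N × Fin N) ⊕ Fin p :=
  Sum.inr (e.symm (k, r, c))

theorem frameIdx_inj {e : Fin p ≃ Fin m × Fin N × Fin N} {k k' : Fin m} {r r' c c' : Fin N} :
    frameIdx e k r c = frameIdx e k' r' c' ↔ k = k' ∧ r = r' ∧ c = c' := by
  simp [frameIdx]

/-- The tuple of matrices stored in the last coordinates. -/
def frameOf (e : Fin p ≃ Fin m × Fin N × Fin N) (z : (Fin N × Fin N) ⊕ Fin p → ℝ) (k : Fin m) :
    Matrix (Fin N) (Fin N) ℝ :=
  Matrix.of fun r c => z (frameIdx e k r c)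

/-- Pairs of a matrix and a line frame summing to it. -/
def frameVariety (e : Fin p ≃ Fin m × Fin N × Fin N) (ℓ : Fin m → ℕ) :
    Set ((Fin N × Fin N) ⊕ Fin p → ℝ) :=
  {z | (∀ r c, z (Sum.inl (r, c)) = ∑ k, frameOf e z k r c) ∧ IsLineFrame ℓ (frameOf e z)}

theorem isLineFrame_iff {ℓ : Fin m → ℕ} {P : Fin m → Matrix (Fin N) (Fin N) ℝ} :
    IsLineFrame ℓ P ↔ (∀ k r c, P k r c - P k c r = 0) ∧
      (∀ k r c s t, P k r c * P k s t - P k r t * P k s c = 0) ∧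
      (∀ k, ∑ r, P k r r - 1 = 0) ∧ (∀ k (r c : Fin N), ℓ k ≤ (r : ℕ) → P k r c = 0) ∧
      ∀ j k, j ≠ k → ∀ r c, ∑ s, P j r s * P k s c = 0 := by
  simp only [sub_eq_zero]
  exact ⟨fun h => ⟨h.1, h.2, h.3, h.4, h.5⟩, fun h => ⟨h.1, h.2.1, h.2.2.1, h.2.2.2.1, h.2.2.2.2⟩⟩

theorem isQAlgebraicSet_frameVariety (e : Fin p ≃ Fin m × Fin N × Fin N) (ℓ : Fin m → ℕ) :
    IsQAlgebraicSet (frameVariety e ℓ) := by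
  simp only [frameVariety, isLineFrame_iff]
  refine .setOf_and (.setOf_forall fun r => .setOf_forall fun c => ?_)
    (.setOf_and (.setOf_forall fun k => .setOf_forall fun r => .setOf_forall fun c => ?_)
    (.setOf_and (.setOf_forall fun k => .setOf_forall fun r => .setOf_forall fun c =>
      .setOf_forall fun s => .setOf_forall fun t => ?_)
    (.setOf_and (.setOf_forall fun k => ?_)
    (.setOf_and (.setOf_forall fun k => .setOf_forall fun r => .setOf_forall fun c =>
      .setOf_imp ?_)
    (.setOf_forall fun j => .setOf_forall fun k => .setOf_imp <| .setOf_forall fun r =>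
      .setOf_forall fun c => ?_)))))
  · convert isQAlgebraicSet_zeroLocus
      (X (Sum.inl (r, c)) - ∑ k, X (frameIdx e k r c) : MvPolynomial _ ℚ) using 3
    simp [frameOf, sub_eq_zero]
  · convert isQAlgebraicSet_zeroLocus
      (X (frameIdx e k r c) - X (frameIdx e k c r) : MvPolynomial _ ℚ) using 3
    simp [frameOf]
  · convert isQAlgebraicSet_zeroLocus
      (X (frameIdx e k r c) * X (frameIdx e k s t) - X (frameIdx e k r t) * X (frameIdx e k s c) :
        MvPolynomial _ ℚ) using 3
    simp [frameOf]
  · convert isQAlgebraicSet_zeroLocus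
      (∑ r, X (frameIdx e k r r) - 1 : MvPolynomial _ ℚ) using 3
    simp [frameOf]
  · convert isQAlgebraicSet_zeroLocus (X (frameIdx e k r c) : MvPolynomial _ ℚ) using 3
    simp [frameOf]
  · convert isQAlgebraicSet_zeroLocus
      (∑ s, X (frameIdx e j r s) * X (frameIdx e k s c) : MvPolynomial _ ℚ) using 3
    simp [frameOf]

theorem sum_sq_of_mem_frameVariety {e : Fin p ≃ Fin m × Fin N × Fin N} {ℓ : Fin m → ℕ}
    {z : (Fin N × Fin N) ⊕ Fin p → ℝ} (hz : z ∈ frameVariety e ℓ) :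
    ∑ i, z i ^ 2 = 2 * (m : ℝ) := by
  obtain ⟨hX, hP⟩ := hz
  rw [Fintype.sum_sum_type, two_mul]
  congr 1
  · have hX' : ∀ r c, z (Sum.inl (r, c)) = (∑ k, frameOf e z k) r c := by
      intro r c
      rw [hX, Matrix.sum_apply]
    rw [Fintype.sum_prod_type]
    simp only [hX']
    rw [sum_sq_eq_trace (hP.transpose_sum _) (hP.sum_mul_sum subset_rfl), hP.trace_sum,
      Finset.card_univ, Fintype.card_fin]
  · rw [← e.symm.sum_comp, Fintype.sum_prod_type]
    simp only [Fintype.sum_prod_type]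
    calc _ = ∑ k, ∑ r, ∑ c, frameOf e z k r c ^ 2 := rfl
      _ = _ := by simp [hP.sum_sq]

/-- Index type of the local equations of `frameVariety` at a point where the diagonal entry of
the `k`-th matrix in position `i k` does not vanish. -/
abbrev LocalIdx (ℓ : Fin m → ℕ) (i : Fin m → Fin N) : Type :=
  (Fin N × Fin N) ⊕
    (k : Fin m) × ((Fin N × {c : Fin N // c ≠ i k}) ⊕
      ({r : Fin N // ℓ k ≤ (r : ℕ)} ⊕ {j : Fin m // j ≤ k}))

/-- Local equations of `frameVariety` with independent gradients. -/
noncomputable def localEq (e : Fin p ≃ Fin m × Fin N × Fin N) (ℓ : Fin m → ℕ) (i : Fin m → Fin N) :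
    LocalIdx ℓ i → MvPolynomial ((Fin N × Fin N) ⊕ Fin p) ℚ
  | .inl (r, c) => X (Sum.inl (r, c)) - ∑ k, X (frameIdx e k r c)
  | .inr ⟨k, .inl (r, c)⟩ => X (frameIdx e k r c) * X (frameIdx e k (i k) (i k))
      - X (frameIdx e k r (i k)) * X (frameIdx e k c (i k))
  | .inr ⟨k, .inr (.inl r)⟩ => X (frameIdx e k r (i k))
  | .inr ⟨k, .inr (.inr j)⟩ => ∑ r, X (frameIdx e j r (i j)) * X (frameIdx e k r (i k))
      - if (j : Fin m) = k then X (frameIdx e k (i k) (i k)) else 0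

variable {e : Fin p ≃ Fin m × Fin N × Fin N} {ℓ : Fin m → ℕ} {i : Fin m → Fin N}
  {z : (Fin N × Fin N) ⊕ Fin p → ℝ}

theorem sum_column_mul_column (hP : IsLineFrame ℓ (frameOf e z)) (j k : Fin m) :
    ∑ r, z (frameIdx e j r (i j)) * z (frameIdx e k r (i k))
      = if j = k then z (frameIdx e k (i k) (i k)) else 0 := by
  have h := congrFun (congrFun (hP.mul_eq_ite j k) (i j)) (i k)
  have hs : ∑ r, z (frameIdx e j r (i j)) * z (frameIdx e k r (i k))
      = (frameOf e z j * frameOf e z k) (i j) (i k) :=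
    Finset.sum_congr rfl fun r _ => by
      rw [← show frameOf e z j r (i j) = z (frameIdx e j r (i j)) from rfl, hP.symm]
      rfl
  rw [hs, h]
  split_ifs with hjk
  · subst hjk; rfl
  · rfl

theorem aeval_localEq_of_mem (hz : z ∈ frameVariety e ℓ) (t : LocalIdx ℓ i) :
    aeval z (localEq e ℓ i t) = 0 := by
  obtain ⟨hX, hP⟩ := hz
  rcases t with ⟨r, c⟩ | ⟨k, ⟨r, c⟩ | r | j⟩
  · simpa [localEq, frameOf, sub_eq_zero] using hX r c
  · have h₁ := hP.minor k r c (i k) (i k)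
    rw [hP.symm k (i k) c] at h₁
    simpa [localEq, frameOf, sub_eq_zero] using h₁
  · simpa [localEq, frameOf] using hP.support k r (i k) r.2
  · have h := sum_column_mul_column (i := i) hP j k
    simp only [localEq, map_sub, map_sum, map_mul, aeval_X, h]
    split_ifs <;> simp

theorem mem_frameVariety_of_aeval_localEq (hi : ∀ k, z (frameIdx e k (i k) (i k)) ≠ 0)
    (hz : ∀ t, aeval z (localEq e ℓ i t) = 0) : z ∈ frameVariety e ℓ := by
  set u : Fin m → Fin N → ℝ := fun k r => z (frameIdx e k r (i k)) with hu
  have hentry : ∀ k r c, frameOf e z k r c = u k r * u k c / u k (i k) := by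
    intro k r c
    rw [eq_div_iff (hi k)]
    by_cases hc : c = i k
    · subst hc; rfl
    · simpa [localEq, frameOf, sub_eq_zero] using hz (.inr ⟨k, .inl (r, ⟨c, hc⟩)⟩)
  have hle : ∀ j k, j ≤ k → ∑ r, u j r * u k r = if j = k then u k (i k) else 0 := by
    intro j k hjk
    have h := hz (.inr ⟨k, .inr (.inr ⟨j, hjk⟩)⟩)
    simp only [localEq, map_sub, map_sum, map_mul, aeval_X, sub_eq_zero] at h
    rw [h]
    split_ifs <;> simp [hu]
  have hsupp : ∀ k (r : Fin N), ℓ k ≤ (r : ℕ) → u k r = 0 := fun k r hr => by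
    simpa [localEq] using hz (.inr ⟨k, .inr (.inl ⟨r, hr⟩)⟩)
  refine ⟨fun r c => by simpa [localEq, frameOf, sub_eq_zero] using hz (.inl (r, c)),
    fun k r c => ?_, fun k r c s t => ?_, fun k => ?_, fun k r c hr => ?_, fun j k hjk r c => ?_⟩
  · rw [hentry, hentry]; ring
  · simp only [hentry]; ring
  · simp only [hentry]
    rw [← Finset.sum_div, hle k k le_rfl, if_pos rfl, div_self (hi k)]
  · rw [hentry, hsupp k r hr]; simp
  · have h0 : ∑ s, u j s * u k s = 0 := by
      rcases le_total j k with h | h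
      · rw [hle j k h, if_neg hjk]
      · simp only [mul_comm (u j _)]
        rw [hle k j h, if_neg (Ne.symm hjk)]
    calc ∑ s, frameOf e z j r s * frameOf e z k s c
        = ∑ s, (u j r / u j (i j) * (u k c / u k (i k))) * (u j s * u k s) :=
          Finset.sum_congr rfl fun s _ => by rw [hentry, hentry]; ring
      _ = 0 := by rw [← Finset.mul_sum, h0, mul_zero]

theorem linearIndependent_localEq (hz : z ∈ frameVariety e ℓ) (hℓ : Monotone ℓ)
    (hi : ∀ k, z (frameIdx e k (i k) (i k)) ≠ 0) :
    LinearIndependent ℝ fun t => polyGradQ (localEq e ℓ i t) z := by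
  refine linearIndependent_polyGradQ z fun g hg => ?_
  have hker : ∀ (v : (Fin N × Fin N) ⊕ Fin p → ℝ) (t₀ : LocalIdx ℓ i),
      polyDirDeriv z v (localEq e ℓ i t₀) ≠ 0 →
      (∀ t, t ≠ t₀ → g t * polyDirDeriv z v (localEq e ℓ i t) = 0) → g t₀ = 0 := by
    intro v t₀ h₀ h
    have := hg v
    rw [Fintype.sum_eq_single t₀ h] at this
    exact (mul_eq_zero.1 this).resolve_right h₀
  have hP := hz.2
  have hsupp : ∀ k (r : Fin N), ℓ k ≤ (r : ℕ) → z (frameIdx e k r (i k)) = 0 := fun k r hr =>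
    hP.support k r (i k) hr
  have hdot := sum_column_mul_column (i := i) hP
  have hX : ∀ r c, g (.inl (r, c)) = 0 := by
    intro r c
    refine hker (Pi.single (Sum.inl (r, c)) 1) _ ?_ ?_
    · simp [localEq, polyDirDeriv_sub, polyDirDeriv_sum, polyDirDeriv_X, frameIdx]
    · rintro (⟨r', c'⟩ | ⟨k', ⟨r', c'⟩ | r' | j'⟩) ht
      · have : (r', c') ≠ (r, c) := fun h => ht (congrArg _ h)
        simp [localEq, polyDirDeriv_sub, polyDirDeriv_sum, polyDirDeriv_X, frameIdx, this]
      · simp [localEq, polyDirDeriv_sub, polyDirDeriv_mul, polyDirDeriv_X, frameIdx]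
      · simp [localEq, polyDirDeriv_X, frameIdx]
      · simp [localEq, polyDirDeriv_sub, polyDirDeriv_sum, polyDirDeriv_mul, polyDirDeriv_X,
          frameIdx, apply_ite]
  have hA : ∀ k r c, g (.inr ⟨k, .inl (r, c)⟩) = 0 := by
    intro k r c
    have hc : ∀ k' r₁ r₂, Pi.single (M := fun _ => ℝ) (frameIdx e k r₁ c) (1 : ℝ)
        (frameIdx e k' r₂ (i k')) = 0 := by
      intro k' r₁ r₂
      rw [Pi.single_apply, if_neg]
      rw [frameIdx_inj]
      rintro ⟨rfl, -, h⟩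
      exact c.2 h.symm
    refine hker (Pi.single (frameIdx e k r c) 1) _ ?_ ?_
    · simpa [localEq, polyDirDeriv_sub, polyDirDeriv_mul, polyDirDeriv_X, hc] using hi k
    · rintro (⟨r', c'⟩ | ⟨k', ⟨r', c'⟩ | r' | j'⟩) ht
      · rw [hX, zero_mul]
      · have : Pi.single (M := fun _ => ℝ) (frameIdx e k r c) (1 : ℝ) (frameIdx e k' r' c') = 0 := by
          rw [Pi.single_apply, if_neg]
          rw [frameIdx_inj]
          rintro ⟨rfl, rfl, h⟩
          exact ht (by rw [Subtype.ext h])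
        simp [localEq, polyDirDeriv_sub, polyDirDeriv_mul, polyDirDeriv_X, hc, this]
      · simp [localEq, polyDirDeriv_X, hc]
      · simp [localEq, polyDirDeriv_sub, polyDirDeriv_sum, polyDirDeriv_mul, polyDirDeriv_X,
          hc, apply_ite]
  -- Test the relation on the direction moving the pivot column of the `k`-th matrix along the
  -- pivot column of the `j`-th one.
  let dir (k j : Fin m) : (Fin N × Fin N) ⊕ Fin p → ℝ := Sum.elim 0 fun s =>
    if (e s).1 = k then z (frameIdx e j (e s).2.1 (i j)) else 0
  have hdir : ∀ k j k' r c, dir k j (frameIdx e k' r c)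
      = if k' = k then z (frameIdx e j r (i j)) else 0 := by
    intro k j k' r c
    simp [dir, frameIdx]
  have hdirS : ∀ k j, j ≤ k → ∀ (k' : Fin m) (r : {r : Fin N // ℓ k' ≤ (r : ℕ)}),
      polyDirDeriv z (dir k j) (localEq e ℓ i (.inr ⟨k', .inr (.inl r)⟩)) = 0 := by
    intro k j hjk k' r
    simp only [localEq, polyDirDeriv_X, hdir]
    split_ifs with h
    · subst h
      exact hsupp j r ((hℓ hjk).trans r.2)
    · rfl
  have hdirO : ∀ k j (k' : Fin m) (j' : {j : Fin m // j ≤ k'}),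
      polyDirDeriv z (dir k j) (localEq e ℓ i (.inr ⟨k', .inr (.inr j')⟩))
        = (if k' = k then if (j' : Fin m) = j then z (frameIdx e j (i j) (i j)) else 0 else 0)
        + (if (j' : Fin m) = k then if k' = j then z (frameIdx e j (i j) (i j)) else 0 else 0)
        - if (j' : Fin m) = k' then if k' = k then z (frameIdx e j (i k) (i j)) else 0 else 0 := by
    intro k j k' j'
    simp only [localEq, polyDirDeriv_sub, polyDirDeriv_sum, polyDirDeriv_mul, polyDirDeriv_X,
      apply_ite (polyDirDeriv z (dir k j)), polyDirDeriv_zero, hdir, aeval_X, mul_ite, mul_zero,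
      Finset.sum_add_distrib]
    congr 1
    · congr 1
      · split_ifs with _ h₂
        · rw [hdot, if_pos h₂]
        · rw [hdot, if_neg h₂]
        · simp
      · split_ifs with _ h₂
        · rw [hdot, if_pos h₂]
        · rw [hdot, if_neg h₂]
        · simp
    · split_ifs with h₁ h₂
      · rw [h₂]
      · rfl
      · rfl
  have hOdiag : ∀ k (h : k ≤ k), g (.inr ⟨k, .inr (.inr ⟨k, h⟩)⟩) = 0 := by
    intro k h
    refine hker (dir k k) _ ?_ ?_
    · simpa [hdirO] using hi k
    · rintro (⟨r', c'⟩ | ⟨k', ⟨r', c'⟩ | r' | ⟨j', hj'⟩⟩) ht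
      · rw [hX, zero_mul]
      · rw [hA, zero_mul]
      · rw [hdirS k k le_rfl, mul_zero]
      · have : ¬(k' = k ∧ j' = k) := by
          rintro ⟨rfl, rfl⟩
          exact ht rfl
        rw [hdirO]
        grind
  have hO : ∀ k j (h : j ≤ k), g (.inr ⟨k, .inr (.inr ⟨j, h⟩)⟩) = 0 := by
    intro k j h
    rcases h.eq_or_lt with rfl | hlt
    · exact hOdiag _ _
    refine hker (dir k j) _ ?_ ?_
    · simpa [hdirO, hlt.ne, hlt.ne'] using hi j
    · rintro (⟨r', c'⟩ | ⟨k', ⟨r', c'⟩ | r' | ⟨j', hj'⟩⟩) ht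
      · rw [hX, zero_mul]
      · rw [hA, zero_mul]
      · rw [hdirS k j h, mul_zero]
      · by_cases hjk' : j' = k'
        · subst hjk'
          rw [hOdiag, zero_mul]
        · have h₁ : ¬(k' = k ∧ j' = j) := by
            rintro ⟨rfl, rfl⟩
            exact ht rfl
          have h₂ : ¬(j' = k ∧ k' = j) := by
            rintro ⟨rfl, rfl⟩
            exact absurd hj' (not_le.2 hlt)
          rw [hdirO]
          grind
  have hS : ∀ k r, g (.inr ⟨k, .inr (.inl r)⟩) = 0 := by
    intro k r
    refine hker (Pi.single (frameIdx e k r (i k)) 1) _ ?_ ?_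
    · simp [localEq, polyDirDeriv_X]
    · rintro (⟨r', c'⟩ | ⟨k', ⟨r', c'⟩ | r' | ⟨j', hj'⟩⟩) ht
      · rw [hX, zero_mul]
      · rw [hA, zero_mul]
      · have : frameIdx e k' r' (i k') ≠ frameIdx e k r (i k) := by
          rw [Ne, frameIdx_inj]
          rintro ⟨rfl, h, -⟩
          exact ht (by rw [Subtype.ext h])
        simp [localEq, polyDirDeriv_X, this]
      · rw [hO, zero_mul]
  rintro (⟨r, c⟩ | ⟨k, ⟨r, c⟩ | r | ⟨j, hj⟩⟩)
  · exact hX r c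
  · exact hA k r c
  · exact hS k r
  · exact hO k j hj

theorem card_localIdx (hℓ : ∀ k, ℓ k ≤ N) :
    Fintype.card (LocalIdx ℓ i)
      = N * N + ∑ k : Fin m, (N * (N - 1) + (N - ℓ k + ((k : ℕ) + 1))) := by
  have h₁ : ∀ k, Fintype.card {r : Fin N // ℓ k ≤ (r : ℕ)} = N - ℓ k := by
    intro k
    have h := Fintype.card_subtype_compl fun r : Fin N => (r : ℕ) < ℓ k
    simp only [not_lt] at h
    rw [h, Fintype.card_fin, Fintype.card_subtype, Fin.card_filter_val_lt, min_eq_right (hℓ k)]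
  have h₂ : ∀ k : Fin m, Fintype.card {j : Fin m // j ≤ k} = (k : ℕ) + 1 := by
    intro k
    rw [Fintype.card_subtype, ← Fin.card_Iic]
    congr 1
    ext j
    simp
  simp [Fintype.card_subtype_compl, h₁, h₂]

theorem isQNonsingular_frameVariety {d : ℕ} (hℓ : Monotone ℓ) (hℓN : ∀ k, ℓ k ≤ N)
    (hd : N * N + ∑ k : Fin m, (N * (N - 1) + (N - ℓ k + ((k : ℕ) + 1)))
      = N * N + m * (N * N) - d) :
    IsQNonsingular d (frameVariety e ℓ) := by
  refine (isQAlgebraicSet_frameVariety e ℓ).isQNonsingular fun z hz => ?_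
  have hpivot : ∀ k, ∃ r, z (frameIdx e k r r) ≠ 0 := by
    intro k
    by_contra! h
    have := hz.2.trace k
    simp [frameOf, h] at this
  choose i hi using hpivot
  have hp : p = m * (N * N) := by simpa using Fintype.card_congr e
  refine ⟨LocalIdx ℓ i, inferInstance, localEq e ℓ i, ?_, fun t x hx => aeval_localEq_of_mem hx t,
    linearIndependent_localEq hz hℓ hi, {x | ∀ k, x (frameIdx e k (i k) (i k)) ≠ 0}, ?_, hi,
    fun x hx h => mem_frameVariety_of_aeval_localEq hx h⟩
  · rw [card_localIdx hℓN, hd, hp]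
    simp
  · rw [Set.ofPred_forall]
    exact isOpen_iInter_of_finite fun k => isOpen_ne_fun (continuous_apply _) continuous_const

end FrameVariety

section Schubert

variable {m n : ℕ} {lam : Fin m → ℕ}

theorem flagIndex_strictMono (hpart : IsPartitionIn n lam) :
    StrictMono fun k : Fin m => n + ((k : ℕ) + 1) - lam k := by
  intro j k hjk
  have h₁ := hpart.1 j
  have h₂ := hpart.2 hjk.le
  have h₃ : (j : ℕ) < k := hjk
  simp only
  omega

theorem flagIndex_le (k : Fin m) : n + ((k : ℕ) + 1) - lam k ≤ m + n := by
  omega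

theorem mem_schubertVariety_iff (hpart : IsPartitionIn n lam)
    {x : Fin (m + n) × Fin (m + n) → ℝ} :
    x ∈ SchubertVariety m n lam ↔ x ∈ Grass m n ∧ ∀ k : Fin m,
      (k : ℕ) < Module.finrank ℝ
        ↥(colSpace (matOf x) ⊓ coordSubspace (m + n) (n + ((k : ℕ) + 1) - lam k)) := by
  refine and_congr_right fun hx => forall_congr' fun k => ?_
  have h := rank_sub_one_mul_stdProj hx.2.1 (flagIndex_le (n := n) (lam := lam) k)
  have := hpart.1 k
  omega

theorem finrank_eq_of_mem_schubertCell (hpart : IsPartitionIn n lam)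
    {x : Fin (m + n) × Fin (m + n) → ℝ} (hx : x ∈ SchubertCell m n lam) (k : Fin m) :
    Module.finrank ℝ
      ↥(colSpace (matOf x) ⊓ coordSubspace (m + n) (n + ((k : ℕ) + 1) - lam k)) = (k : ℕ) + 1 := by
  refine hx.2 k _ le_rfl ?_
  have : lamNext lam k ≤ lam k := by
    rw [lamNext]
    split_ifs with h
    · exact hpart.2 (Fin.le_def.2 (Nat.le_succ _))
    · exact Nat.zero_le _
  omega

theorem sum_partition_le (hpart : IsPartitionIn n lam) : ∑ k, lam k ≤ m * n := by
  simpa using Finset.sum_le_card_nsmul Finset.univ lam n fun k _ => hpart.1 k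

theorem codimension_count (hpart : IsPartitionIn n lam) :
    (m + n) * (m + n) + ∑ k : Fin m, ((m + n) * (m + n - 1)
        + (m + n - (n + ((k : ℕ) + 1) - lam k) + ((k : ℕ) + 1)))
      = (m + n) * (m + n) + m * ((m + n) * (m + n)) - (m * n - ∑ k, lam k) := by
  have hterm : ∀ k : Fin m, (m + n) * (m + n - 1)
      + (m + n - (n + ((k : ℕ) + 1) - lam k) + ((k : ℕ) + 1)) + n
      = (m + n) * (m + n) + lam k := by
    intro k
    have h₁ := hpart.1 k
    have h₂ := k.2
    have h₃ : (m + n) * (m + n - 1) + (m + n) = (m + n) * (m + n) := by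
      obtain ⟨N, hN⟩ : ∃ N, m + n = N + 1 := ⟨m + n - 1, by omega⟩
      rw [hN, Nat.add_sub_cancel]
      ring
    omega
  have hsum : ∑ k : Fin m, ((m + n) * (m + n - 1)
      + (m + n - (n + ((k : ℕ) + 1) - lam k) + ((k : ℕ) + 1))) + m * n
      = m * ((m + n) * (m + n)) + ∑ k, lam k :=
    calc _ = ∑ k : Fin m, ((m + n) * (m + n - 1)
            + (m + n - (n + ((k : ℕ) + 1) - lam k) + ((k : ℕ) + 1)) + n) := by
          rw [Finset.sum_add_distrib (g := fun _ => n)]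
          simp
      _ = ∑ k : Fin m, ((m + n) * (m + n) + lam k) := Finset.sum_congr rfl fun k _ => hterm k
      _ = _ := by
          rw [Finset.sum_add_distrib]
          simp
  have hle := sum_partition_le hpart
  generalize m * ((m + n) * (m + n)) = a at hsum ⊢
  generalize m * n = b at hsum hle ⊢
  generalize ∑ k, lam k = c at hsum hle ⊢
  omega

theorem matOf_eq_sum_of_mem_frameVariety {N p : ℕ} {e : Fin p ≃ Fin m × Fin N × Fin N}
    {ℓ : Fin m → ℕ} {z : (Fin N × Fin N) ⊕ Fin p → ℝ} (hz : z ∈ frameVariety e ℓ) :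
    matOf (fun q => z (Sum.inl q)) = ∑ k, frameOf e z k := by
  ext r c
  rw [Matrix.sum_apply]
  exact hz.1 r c

theorem exists_mem_frameVariety {N p : ℕ} (e : Fin p ≃ Fin m × Fin N × Fin N) {ℓ : Fin m → ℕ}
    {x : Fin N × Fin N → ℝ} {P : Fin m → Matrix (Fin N) (Fin N) ℝ} (hP : IsLineFrame ℓ P)
    (hx : ∑ k, P k = matOf x) :
    ∃ z ∈ frameVariety e ℓ, (fun q => z (Sum.inl q)) = x := by
  refine ⟨Sum.elim x fun s => P (e s).1 (e s).2.1 (e s).2.2, ?_, rfl⟩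
  have hframe : frameOf e (Sum.elim x fun s => P (e s).1 (e s).2.1 (e s).2.2) = P := by
    ext k r c
    simp [frameOf, frameIdx]
  refine ⟨fun r c => ?_, by rwa [hframe]⟩
  rw [hframe, ← Matrix.sum_apply, hx]
  rfl

theorem image_frameVariety (hpart : IsPartitionIn n lam) {p : ℕ}
    (e : Fin p ≃ Fin m × Fin (m + n) × Fin (m + n)) :
    (fun (z : (Fin (m + n) × Fin (m + n)) ⊕ Fin p → ℝ) q => z (Sum.inl q)) ''
      frameVariety e (fun k => n + ((k : ℕ) + 1) - lam k) = SchubertVariety m n lam := by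
  ext x
  constructor
  · rintro ⟨z, hz, rfl⟩
    have hX := matOf_eq_sum_of_mem_frameVariety hz
    refine (mem_schubertVariety_iff hpart).2 ⟨?_, fun k => ?_⟩
    · change matOf _ ∈ GrassMatrix (m + n) m
      rw [hX]
      exact ⟨hz.2.transpose_sum _, hz.2.sum_mul_sum subset_rfl,
        by rw [hz.2.trace_sum, Finset.card_univ, Fintype.card_fin]⟩
    · rw [hX]
      exact hz.2.le_finrank (flagIndex_strictMono hpart).monotone k
  · intro hx
    obtain ⟨hG, hdim⟩ := (mem_schubertVariety_iff hpart).1 hx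
    obtain ⟨P, hP, hPx⟩ := exists_isLineFrame hG hdim
    exact exists_mem_frameVariety e hP hPx

theorem eq_of_mem_frameVariety (hpart : IsPartitionIn n lam) {p : ℕ}
    {e : Fin p ≃ Fin m × Fin (m + n) × Fin (m + n)} {A : Fin (m + n) × Fin (m + n) → ℝ}
    (hA : A ∈ SchubertCell m n lam) {z z' : (Fin (m + n) × Fin (m + n)) ⊕ Fin p → ℝ}
    (hz : z ∈ frameVariety e (fun k => n + ((k : ℕ) + 1) - lam k))
    (hz' : z' ∈ frameVariety e (fun k => n + ((k : ℕ) + 1) - lam k))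
    (hzA : (fun q => z (Sum.inl q)) = A) (hzA' : (fun q => z' (Sum.inl q)) = A) : z = z' := by
  have hX := matOf_eq_sum_of_mem_frameVariety hz
  have hX' := matOf_eq_sum_of_mem_frameVariety hz'
  rw [hzA] at hX
  rw [hzA'] at hX'
  have hframe : frameOf e z = frameOf e z' := by
    refine hz.2.eq_of_sum_eq hz'.2 (flagIndex_strictMono hpart).monotone (hX.symm.trans hX')
      fun k => ?_
    rw [← hX]
    exact finrank_eq_of_mem_schubertCell hpart hA k
  funext i
  rcases i with q | s
  · exact congrFun (hzA.trans hzA'.symm) q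
  · have h := congrFun (congrFun (congrFun hframe (e s).1) (e s).2.1) (e s).2.2
    simpa [frameOf, frameIdx] using h

end Schubert

/-- **`ℚ`-desingularization of embedded Schubert varieties.** -/
theorem schubert_Q_desingularization
    (m n : ℕ) (lam : Fin m → ℕ) (hpart : IsPartitionIn n lam) :
    ∃ (p : ℕ) (Z : Set ((Fin (m + n) × Fin (m + n)) ⊕ Fin p → ℝ)),
      IsProjQClosed Z ∧
      IsQNonsingular (m * n - ∑ k, lam k) Z ∧
      ((fun z : (Fin (m + n) × Fin (m + n)) ⊕ Fin p → ℝ => fun q => z (Sum.inl q)) '' Z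
        = SchubertVariety m n lam) ∧
      ∀ A ∈ SchubertCell m n lam,
        ∃! z : (Fin (m + n) × Fin (m + n)) ⊕ Fin p → ℝ,
          z ∈ Z ∧ (fun q => z (Sum.inl q)) = A := by
  let e := (Fintype.equivFin (Fin m × Fin (m + n) × Fin (m + n))).symm
  refine ⟨_, frameVariety e fun k => n + ((k : ℕ) + 1) - lam k, ?_, ?_,
    image_frameVariety hpart e, fun A hA => ?_⟩
  · refine (isQAlgebraicSet_frameVariety e _).isProjQClosed (2 * m) fun z hz => ?_
    rw [sum_sq_of_mem_frameVariety hz]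
    push_cast
    rfl
  · exact isQNonsingular_frameVariety (flagIndex_strictMono hpart).monotone flagIndex_le
      (codimension_count hpart)
  · have hAσ : A ∈ SchubertVariety m n lam := (mem_schubertVariety_iff hpart).2
      ⟨hA.1, fun k => by rw [finrank_eq_of_mem_schubertCell hpart hA]; exact Nat.lt_succ_self _⟩
    rw [← image_frameVariety hpart e] at hAσ
    obtain ⟨z, hz, hzA⟩ := hAσ
    exact ⟨z, ⟨hz, hzA⟩, fun z' hz' => eq_of_mem_frameVariety hpart hA hz'.1 hz hz'.2 hzA⟩
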